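/- Let E be a real vector space, let G be a finite group acting on E by linear maps, and suppose the only vector of E fixed by every element of G is 0. If f : E → ℝ is a convex function which is G-invariant (f(g • x) = f(x) for all g ∈ G, x ∈ E), then f attains its global minimum at 0; that is, f(0) ≤ f(x) for every x ∈ E. -/

import Mathlib

/-- If a finite group `G` acts linearly on a real vector space `E`
with `0` as the only vector fixed by every element of `G`, then every `G`-invariant
convex function `f : E → ℝ` attains its global minimum at `0`. -/
theorem convex_invariant_min_at_fixed_point
    {E : Type*} [AddCommGroup E] [Module ℝ E]
    {G : Type*} [Group G] [Finite G]
    [DistribMulAction G E] [SMulCommClass G ℝ E]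
    (hfix : ∀ x : E, (∀ g : G, g • x = x) → x = 0)
    (f : E → ℝ) (hconv : ConvexOn ℝ Set.univ f)
    (hinv : ∀ (g : G) (x : E), f (g • x) = f x) :
    ∀ x : E, f 0 ≤ f x := by
  intro x
  have := Fintype.ofFinite G
  have hsum : ∑ g : G, g • x = 0 := hfix _ fun h => by
    simp only [Finset.smul_sum, smul_smul]
    exact Equiv.sum_comp (Equiv.mulLeft h) fun g => g • x
  have hweights : ∑ _g : G, (Fintype.card G : ℝ)⁻¹ = 1 := by simp
  have hjensen := hconv.map_sum_le (t := Finset.univ) (p := fun g : G => g • x)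
    (fun _ _ => by positivity) hweights (fun _ _ => Set.mem_univ _)
  simp only [hinv] at hjensen
  rwa [← Finset.smul_sum, hsum, smul_zero, ← Finset.sum_smul, hweights, one_smul] at hjensen
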